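/- arXiv:1904.01625 — 2 statements merged into one kernel-verified Lean document; each statement's English description precedes it below -/
import Mathlib

section
/- Let B be a finite subset of the square torus T = (ℝ/ℤ) × (ℝ/ℤ) with (0,0) ∈ B and |B| > 2. Suppose that for every pair of coprime integers (p,q), the image of B under the group homomorphism λ_{p,q} : T → ℝ/ℤ given by λ_{p,q}(x,y) = q·x − p·y has exactly 2 elements. Then every element of B is a 2-torsion point of T (i.e. B is contained in the subgroup {v ∈ T : 2·v = 0}), and consequently |B| = 3 or |B| = 4. -/
/-- The square torus `(ℝ/ℤ) × (ℝ/ℤ)`. -/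
abbrev SquareTorus : Type := AddCircle (1 : ℝ) × AddCircle (1 : ℝ)

/-- For coprime integers `(p, q)`, the group homomorphism
`λ_{p,q}(x,y) = q·x - p·y` from the square torus to `ℝ/ℤ`. -/
noncomputable def lamPQ (p q : ℤ) : SquareTorus → AddCircle (1 : ℝ) :=
  fun v => q • v.1 - p • v.2

/-- Among any three elements of a set whose image under `f` has two elements, two have the same
image. -/
theorem Set.eq_or_eq_or_eq_of_ncard_image_eq_two {α β : Type*} {f : α → β} {s : Set α}
    (h : (f '' s).ncard = 2) {u v w : α} (hu : u ∈ s) (hv : v ∈ s) (hw : w ∈ s) :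
    f u = f v ∨ f u = f w ∨ f v = f w := by
  obtain ⟨a, b, -, hab⟩ := Set.ncard_eq_two.mp h
  have key : ∀ x ∈ s, f x = a ∨ f x = b := fun x hx ↦ by
    simpa [hab] using Set.mem_image_of_mem f hx
  grind

/-- If the three points `0`, `(a, b)`, `(c, d)` are distinct and each of the four homomorphisms
`x`, `y`, `x - y`, `x + y` identifies two of them, then `(a, b)` is 2-torsion. -/
theorem two_torsion_of_identifications {G : Type*} [AddCommGroup G] {a b c d : G}
    (h_ab : a ≠ 0 ∨ b ≠ 0) (h_cd : c ≠ 0 ∨ d ≠ 0) (h_ne : a ≠ c ∨ b ≠ d)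
    (hx : 0 = a ∨ 0 = c ∨ a = c) (hy : 0 = b ∨ 0 = d ∨ b = d)
    (h_sub : 0 = a - b ∨ 0 = c - d ∨ a - b = c - d)
    (h_add : 0 = a + b ∨ 0 = c + d ∨ a + b = c + d) :
    2 • a = 0 ∧ 2 • b = 0 := by
  rw [eq_comm, sub_eq_zero, eq_comm (a := (0 : G)) (b := c - d), sub_eq_zero] at h_sub
  rw [eq_comm, add_eq_zero_iff_eq_neg, eq_comm (a := (0 : G)) (b := c + d),
    add_eq_zero_iff_eq_neg] at h_add
  rcases hx with rfl | rfl | rfl <;> rcases hy with rfl | rfl | rfl <;>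
    rcases h_sub with h | h | h <;> rcases h_add with h' | h' | h' <;>
    grind [eq_neg_iff_add_eq_zero]

/-- A torus with more than two marked points (including the origin) that splits
into exactly two cylinders in every rational direction has all its marked
points among the 2-torsion points; consequently there are 3 or 4 of them. -/
theorem torus_two_torsion
    (B : Finset SquareTorus)
    (h0 : (0 : SquareTorus) ∈ B)
    (hcard : 2 < B.card)
    (htwo : ∀ p q : ℤ, IsCoprime p q →
      ((lamPQ p q) '' (B : Set SquareTorus)).ncard = 2) :
    (∀ v ∈ B, 2 • v = (0 : SquareTorus)) ∧ (B.card = 3 ∨ B.card = 4) := by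
  have hx := htwo 0 1 isCoprime_one_right
  have hy := htwo (-1) 0 (by norm_num)
  have h_sub := htwo 1 1 isCoprime_one_right
  have h_add := htwo (-1) 1 isCoprime_one_right
  refine ⟨fun v hv ↦ ?_, ?_⟩
  · by_cases hv0 : v = 0
    · simp [hv0]
    obtain ⟨w, hw, hw'⟩ := Finset.exists_mem_notMem_of_card_lt_card
      (lt_of_le_of_lt (Finset.card_le_two (a := (0 : SquareTorus)) (b := v)) hcard)
    obtain ⟨hw0, hwv⟩ : w ≠ 0 ∧ w ≠ v := by simpa using hw'
    have hx3 := Set.eq_or_eq_or_eq_of_ncard_image_eq_two hx h0 hv hw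
    have hy3 := Set.eq_or_eq_or_eq_of_ncard_image_eq_two hy h0 hv hw
    have h_sub3 := Set.eq_or_eq_or_eq_of_ncard_image_eq_two h_sub h0 hv hw
    have h_add3 := Set.eq_or_eq_or_eq_of_ncard_image_eq_two h_add h0 hv hw
    simp only [lamPQ, Prod.fst_zero, Prod.snd_zero, smul_zero, zero_smul, one_smul, neg_smul,
      sub_zero, sub_neg_eq_add, zero_add] at hx3 hy3 h_sub3 h_add3
    obtain ⟨a, b⟩ := v
    obtain ⟨c, d⟩ := w
    simp only [ne_eq, Prod.mk_eq_zero, Prod.mk.injEq, not_and_or] at hv0 hw0 hwv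
    have := two_torsion_of_identifications hv0 hw0
      (hwv.imp Ne.symm Ne.symm) hx3 hy3 h_sub3 h_add3
    simpa using this
  · have hsub : (B : Set SquareTorus) ⊆
        (lamPQ 0 1 '' (B : Set SquareTorus)) ×ˢ (lamPQ (-1) 0 '' (B : Set SquareTorus)) :=
      fun v hv ↦ ⟨⟨v, hv, by simp [lamPQ]⟩, ⟨v, hv, by simp [lamPQ]⟩⟩
    have hle := Set.ncard_le_ncard hsub
      ((B.finite_toSet.image _).prod (B.finite_toSet.image _))
    rw [Set.ncard_prod, hx, hy, Set.ncard_coe_finset] at hle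
    omega
end

section
/- Let x, y ∈ ℝ/ℤ with x ≠ 0 and y ≠ 0, and let S = {0, x} × {0, y} ⊆ T, where T = (ℝ/ℤ) × (ℝ/ℤ). Let σ, τ : T → T be the automorphisms σ(u,v) = (u+v, v) and τ(u,v) = (u, u+v) (induced by the two standard unipotent matrices in SL₂(ℤ)). If σ(S) = S and τ(S) = S, then x = y = the class of 1/2 in ℝ/ℤ; that is, S is exactly the subgroup of 2-torsion points of T. -/
theorem AddCircle.two_nsmul_eq_zero_iff (u : AddCircle (1 : ℝ)) :
    2 • u = 0 ↔ u = 0 ∨ u = ((1 / 2 : ℝ) : AddCircle (1 : ℝ)) := by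
  constructor
  · induction u using QuotientAddGroup.induction_on with
    | H a =>
      intro h
      obtain ⟨n, hn⟩ := (AddCircle.coe_eq_zero_iff (1 : ℝ) (x := 2 • a)).1 h
      rw [zsmul_one, two_nsmul] at hn
      obtain ⟨k, rfl | rfl⟩ := Int.even_or_odd' n
      · left
        refine (AddCircle.coe_eq_zero_iff (1 : ℝ)).2 ⟨k, ?_⟩
        push_cast at hn
        rw [zsmul_one]
        linarith
      · right
        rw [← sub_eq_zero]
        refine (AddCircle.coe_eq_zero_iff (1 : ℝ) (x := a - 1 / 2)).2 ⟨k, ?_⟩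
        push_cast at hn
        rw [zsmul_one]
        linarith
  · rintro (rfl | rfl)
    · exact nsmul_zero 2
    · rw [← AddCircle.coe_nsmul, two_nsmul, add_halves]
      exact AddCircle.coe_period 1


/-- A four-point set `{0,x} × {0,y}` in the square torus which is invariant
under both standard unipotent automorphisms must be exactly the set of
2-torsion points, i.e. `x = y = 1/2`. -/
theorem unipotent_invariant_is_two_torsion
    (x y : AddCircle (1 : ℝ)) (hx : x ≠ 0) (hy : y ≠ 0)
    (S : Set (AddCircle (1 : ℝ) × AddCircle (1 : ℝ)))
    (hS : S = ({0, x} : Set (AddCircle (1 : ℝ))) ×ˢ ({0, y} : Set (AddCircle (1 : ℝ))))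
    (hσ : (fun v : AddCircle (1 : ℝ) × AddCircle (1 : ℝ) => (v.1 + v.2, v.2)) '' S = S)
    (hτ : (fun v : AddCircle (1 : ℝ) × AddCircle (1 : ℝ) => (v.1, v.1 + v.2)) '' S = S) :
    x = ((1 / 2 : ℝ) : AddCircle (1 : ℝ)) ∧
    y = ((1 / 2 : ℝ) : AddCircle (1 : ℝ)) ∧
    S = {v : AddCircle (1 : ℝ) × AddCircle (1 : ℝ) | 2 • v = 0} := by
  subst hS
  have hyx : y = x := by
    have h := hσ.subset (Set.mem_image_of_mem _ (show (0, y) ∈ _ by simp))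
    simpa [hy] using h
  subst hyx
  have hyy : 2 • y = 0 := by
    have h := hσ.subset (Set.mem_image_of_mem _ (show (y, y) ∈ _ by simp))
    simpa [hy, two_nsmul] using h
  have hhalf := ((AddCircle.two_nsmul_eq_zero_iff y).1 hyy).resolve_left hy
  refine ⟨hhalf, hhalf, ?_⟩
  ext ⟨u, v⟩
  rw [Set.mem_ofPred_eq, Prod.smul_mk, Prod.mk_eq_zero, AddCircle.two_nsmul_eq_zero_iff,
    AddCircle.two_nsmul_eq_zero_iff, ← hhalf]
  rfl
end
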